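/- Let n ≥ 1, let γ ∈ ℝ with γ ≠ 1, let ρ, μ : ℝⁿ → ℝ be smooth with ρ > 0 and μ > 0, and let Φ : ℝⁿ → ℝ be smooth with compact support. Define the generator L_γ g = γ·μ^{γ−2}·⟨∇μ, ∇g⟩ + μ^{γ−1}·Δg, the γ-Gamma-one operator Γ_{γ,1}(Φ₁, Φ₂, ρ) = ⟨∇Φ₁, ∇Φ₂⟩·ρ^{γ−1}, and the γ-Gamma-two operator Γ_{γ,2}(Φ, Φ, ρ) = (γ/2)·L_γ( Γ_{γ,1}(Φ, Φ, ρ) ) − Γ_{γ,1}(Φ, L_γΦ, ρ). Then ∫_{ℝⁿ} Γ_{γ,2}(Φ, Φ, ρ)(x)·ρ(x) dx = ∫_{ℝⁿ} ρ^γ { −Δ(μ^{γ−1})·‖∇Φ‖² − (1/(γ−1))·Hess(μ^{γ−1})(∇Φ, ∇Φ) + μ^{γ−1}·‖Hess Φ‖² + γ(γ−1)·μ^{γ−1}·( ⟨∇ρ/ρ, ∇Φ⟩·⟨∇μ/μ, ∇Φ⟩ − (1/2)·⟨∇ρ/ρ, ∇μ/μ + ∇ρ/ρ⟩·‖∇Φ‖²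 ) } dx. -/

import Mathlib

open MeasureTheory Filter Set
open scoped InnerProductSpace Topology

/-- Partial derivative `∂ⱼ f x` on Euclidean space. -/
noncomputable def pder (n : ℕ) (j : Fin n) (f : EuclideanSpace ℝ (Fin n) → ℝ)
    (x : EuclideanSpace ℝ (Fin n)) : ℝ :=
  fderiv ℝ f x (EuclideanSpace.single j 1)

/-- Divergence `∇·v` of a vector field on Euclidean space. -/
noncomputable def divg (n : ℕ) (v : EuclideanSpace ℝ (Fin n) → EuclideanSpace ℝ (Fin n))
    (x : EuclideanSpace ℝ (Fin n)) : ℝ :=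
  ∑ j, pder n j (fun y => v y j) x

/-- Laplacian `Δf = ∑ⱼ ∂ⱼ∂ⱼ f`. -/
noncomputable def lapl (n : ℕ) (f : EuclideanSpace ℝ (Fin n) → ℝ)
    (x : EuclideanSpace ℝ (Fin n)) : ℝ :=
  ∑ j, pder n j (fun y => pder n j f y) x

/-- Entry `(i,j)` of the Hessian matrix of `f`. -/
noncomputable def hessij (n : ℕ) (f : EuclideanSpace ℝ (Fin n) → ℝ)
    (x : EuclideanSpace ℝ (Fin n)) (i j : Fin n) : ℝ :=
  pder n i (fun y => pder n j f y) x

/-- Hessian quadratic form `Hess f (u,u) = ∑ᵢⱼ (∂ᵢ∂ⱼf) uᵢ uⱼ`. -/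
noncomputable def hessQF (n : ℕ) (f : EuclideanSpace ℝ (Fin n) → ℝ)
    (x u : EuclideanSpace ℝ (Fin n)) : ℝ :=
  ∑ i, ∑ j, hessij n f x i j * u i * u j

/-- Squared Frobenius norm of the Hessian: `‖Hess f‖² = ∑ᵢⱼ (∂ᵢ∂ⱼf)²`. -/
noncomputable def hessFrob (n : ℕ) (f : EuclideanSpace ℝ (Fin n) → ℝ)
    (x : EuclideanSpace ℝ (Fin n)) : ℝ :=
  ∑ i, ∑ j, (hessij n f x i j)^2

/-- The generator `L_γ g = γ μ^{γ−2} ⟨∇μ, ∇g⟩ + μ^{γ−1} Δg` of the γ-drift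
diffusion process. -/
noncomputable def Lgen (n : ℕ) (γ : ℝ) (μ g : EuclideanSpace ℝ (Fin n) → ℝ)
    (x : EuclideanSpace ℝ (Fin n)) : ℝ :=
  γ * (μ x)^(γ-2) * ⟪gradient μ x, gradient g x⟫_ℝ + (μ x)^(γ-1) * lapl n g x

/-- The γ-Gamma-one operator `Γ_{γ,1}(Φ₁, Φ₂, ρ) = ⟨∇Φ₁, ∇Φ₂⟩ ρ^{γ−1}`. -/
noncomputable def Gamma1 (n : ℕ) (γ : ℝ) (ρ Φ₁ Φ₂ : EuclideanSpace ℝ (Fin n) → ℝ)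
    (x : EuclideanSpace ℝ (Fin n)) : ℝ :=
  ⟪gradient Φ₁ x, gradient Φ₂ x⟫_ℝ * (ρ x)^(γ-1)

/-- The γ-Gamma-two operator
`Γ_{γ,2}(Φ, Φ, ρ) = (γ/2) L_γ(Γ_{γ,1}(Φ,Φ,ρ)) − Γ_{γ,1}(Φ, L_γΦ, ρ)`. -/
noncomputable def Gamma2 (n : ℕ) (γ : ℝ) (μ ρ Φ : EuclideanSpace ℝ (Fin n) → ℝ)
    (x : EuclideanSpace ℝ (Fin n)) : ℝ :=
  (γ/2) * Lgen n γ μ (Gamma1 n γ ρ Φ Φ) x - Gamma1 n γ ρ Φ (Lgen n γ μ Φ) x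

section PartialDerivatives

variable {n : ℕ} {f g h : EuclideanSpace ℝ (Fin n) → ℝ} {x : EuclideanSpace ℝ (Fin n)}

/-- The pointwise inner product of gradients `∇f · ∇g = ∑ⱼ ∂ⱼf ∂ⱼg`. -/
noncomputable def gradInner (n : ℕ) (f g : EuclideanSpace ℝ (Fin n) → ℝ)
    (x : EuclideanSpace ℝ (Fin n)) : ℝ :=
  ∑ j, pder n j f x * pder n j g x

lemma gradient_apply_eq_pder (j : Fin n) : gradient f x j = pder n j f x := by
  have : ⟪gradient f x, EuclideanSpace.single j (1 : ℝ)⟫_ℝ = pder n j f x := by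
    rw [gradient, InnerProductSpace.toDual_symm_apply, pder]
  rw [← this, EuclideanSpace.inner_single_right]
  simp

lemma inner_gradient_eq_gradInner : ⟪gradient f x, gradient g x⟫_ℝ = gradInner n f g x := by
  simp only [PiLp.inner_apply, gradient_apply_eq_pder, gradInner]
  exact Finset.sum_congr rfl fun j _ => by simp [mul_comm]

lemma norm_gradient_sq_eq_gradInner : ‖gradient f x‖ ^ 2 = gradInner n f f x := by
  rw [← real_inner_self_eq_norm_sq, inner_gradient_eq_gradInner]

lemma gradInner_comm : gradInner n f g = gradInner n g f :=
  funext fun _ => Finset.sum_congr rfl fun _ _ => mul_comm _ _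

lemma contDiff_pder (hf : ContDiff ℝ (⊤ : ℕ∞) f) (j : Fin n) :
    ContDiff ℝ (⊤ : ℕ∞) (pder n j f) :=
  (hf.fderiv_right (by simp)).clm_apply contDiff_const

lemma contDiff_gradInner (hf : ContDiff ℝ (⊤ : ℕ∞) f) (hg : ContDiff ℝ (⊤ : ℕ∞) g) :
    ContDiff ℝ (⊤ : ℕ∞) (gradInner n f g) :=
  ContDiff.sum fun j _ => (contDiff_pder hf j).mul (contDiff_pder hg j)

lemma contDiff_lapl (hf : ContDiff ℝ (⊤ : ℕ∞) f) : ContDiff ℝ (⊤ : ℕ∞) (lapl n f) :=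
  ContDiff.sum fun j _ => contDiff_pder (contDiff_pder hf j) j

lemma ContDiff.differentiableAt_of_top (hf : ContDiff ℝ (⊤ : ℕ∞) f) : DifferentiableAt ℝ f x :=
  hf.differentiable (by simp) x

lemma pder_mul (hf : ContDiff ℝ (⊤ : ℕ∞) f) (hg : ContDiff ℝ (⊤ : ℕ∞) g) (j : Fin n) :
    pder n j (fun y => f y * g y) x = f x * pder n j g x + g x * pder n j f x := by
  rw [pder, fderiv_fun_mul hf.differentiableAt_of_top hg.differentiableAt_of_top]
  simp [pder]

lemma pder_add (hf : ContDiff ℝ (⊤ : ℕ∞) f) (hg : ContDiff ℝ (⊤ : ℕ∞) g) (j : Fin n) :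
    pder n j (fun y => f y + g y) x = pder n j f x + pder n j g x := by
  rw [pder, fderiv_fun_add hf.differentiableAt_of_top hg.differentiableAt_of_top]
  simp [pder]

lemma pder_const_mul (hf : ContDiff ℝ (⊤ : ℕ∞) f) (c : ℝ) (j : Fin n) :
    pder n j (fun y => c * f y) x = c * pder n j f x := by
  rw [pder, fderiv_const_mul hf.differentiableAt_of_top]
  simp [pder]

lemma pder_sum {F : Fin n → EuclideanSpace ℝ (Fin n) → ℝ}
    (hF : ∀ i, ContDiff ℝ (⊤ : ℕ∞) (F i)) (j : Fin n) :
    pder n j (fun y => ∑ i, F i y) x = ∑ i, pder n j (F i) x := by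
  rw [pder, fderiv_fun_sum fun i _ => (hF i).differentiableAt_of_top]
  simp [pder]

lemma contDiff_rpow_const (hf : ContDiff ℝ (⊤ : ℕ∞) f) (hpos : ∀ x, 0 < f x) (s : ℝ) :
    ContDiff ℝ (⊤ : ℕ∞) fun y => f y ^ s :=
  hf.rpow_const_of_ne fun x => (hpos x).ne'

lemma pder_rpow_const (hf : ContDiff ℝ (⊤ : ℕ∞) f) (hpos : ∀ x, 0 < f x) (s : ℝ) (j : Fin n) :
    pder n j (fun y => f y ^ s) x = s * f x ^ (s - 1) * pder n j f x := by
  have := (hf.differentiableAt_of_top (x := x)).hasFDerivAt.rpow_const (p := s)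
    (Or.inl (hpos x).ne')
  rw [pder, this.fderiv]
  simp [pder]

lemma pder_comm (hf : ContDiff ℝ (⊤ : ℕ∞) f) (i j : Fin n) :
    pder n i (pder n j f) x = pder n j (pder n i f) x := by
  have hd : DifferentiableAt ℝ (fderiv ℝ f) x :=
    (hf.fderiv_right (m := (⊤ : ℕ∞)) (by simp)).differentiable (by simp) x
  have key (u v : EuclideanSpace ℝ (Fin n)) :
      fderiv ℝ (fun y => fderiv ℝ f y u) x v = fderiv ℝ (fderiv ℝ f) x v u := by
    rw [fderiv_clm_apply hd (differentiableAt_const u)]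
    simp
  have hsymm : IsSymmSndFDerivAt ℝ f x := hf.contDiffAt.isSymmSndFDerivAt <| by
    rw [minSmoothness_of_isRCLikeNormedField]
    exact WithTop.coe_le_coe.2 (le_top : (2 : ℕ∞) ≤ ⊤)
  change fderiv ℝ (fun y => fderiv ℝ f y _) x _ = fderiv ℝ (fun y => fderiv ℝ f y _) x _
  rw [key, key, hsymm.eq]

lemma gradInner_mul_right (hg : ContDiff ℝ (⊤ : ℕ∞) g) (hh : ContDiff ℝ (⊤ : ℕ∞) h) :
    gradInner n f (fun y => g y * h y) x
      = g x * gradInner n f h x + h x * gradInner n f g x := by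
  simp only [gradInner, pder_mul hg hh, Finset.mul_sum, ← Finset.sum_add_distrib]
  exact Finset.sum_congr rfl fun j _ => by ring

lemma gradInner_mul_left (hg : ContDiff ℝ (⊤ : ℕ∞) g) (hh : ContDiff ℝ (⊤ : ℕ∞) h) :
    gradInner n (fun y => g y * h y) f x
      = g x * gradInner n h f x + h x * gradInner n g f x := by
  simp only [gradInner_comm (g := f), gradInner_mul_right hg hh]

lemma gradInner_add_right (hg : ContDiff ℝ (⊤ : ℕ∞) g) (hh : ContDiff ℝ (⊤ : ℕ∞) h) :
    gradInner n f (fun y => g y + h y) x = gradInner n f g x + gradInner n f h x := by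
  simp only [gradInner, pder_add hg hh, mul_add, Finset.sum_add_distrib]

lemma gradInner_const_mul_right (hg : ContDiff ℝ (⊤ : ℕ∞) g) (c : ℝ) :
    gradInner n f (fun y => c * g y) x = c * gradInner n f g x := by
  simp only [gradInner, pder_const_mul hg, Finset.mul_sum]
  exact Finset.sum_congr rfl fun j _ => by ring

lemma gradInner_rpow_left (hf : ContDiff ℝ (⊤ : ℕ∞) f) (hpos : ∀ x, 0 < f x) (s : ℝ) :
    gradInner n (fun y => f y ^ s) g x = s * f x ^ (s - 1) * gradInner n f g x := by
  simp only [gradInner, pder_rpow_const hf hpos, Finset.mul_sum]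
  exact Finset.sum_congr rfl fun j _ => by ring

lemma pder_gradInner (hf : ContDiff ℝ (⊤ : ℕ∞) f) (hg : ContDiff ℝ (⊤ : ℕ∞) g) (i : Fin n) :
    pder n i (gradInner n f g) x
      = ∑ j, (pder n j f x * pder n i (pder n j g) x + pder n j g x * pder n i (pder n j f) x) := by
  change pder n i (fun y => ∑ j, pder n j f y * pder n j g y) x = _
  rw [pder_sum fun j => (contDiff_pder hf j).mul (contDiff_pder hg j)]
  exact Finset.sum_congr rfl fun j _ => pder_mul (contDiff_pder hf j) (contDiff_pder hg j) i

/-- `∇f · ∇(∇g · ∇f) = Hess g (∇f, ∇f) + ½ ∇g · ∇‖∇f‖²`. -/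
lemma gradInner_gradInner (hf : ContDiff ℝ (⊤ : ℕ∞) f) (hg : ContDiff ℝ (⊤ : ℕ∞) g) :
    gradInner n f (gradInner n g f) x
      = hessQF n g x (gradient f x) + 1 / 2 * gradInner n g (gradInner n f f) x := by
  have hsymm : ∑ i, ∑ j, pder n i f x * (pder n j g x * pder n i (pder n j f) x)
      = ∑ i, ∑ j, pder n i g x * (pder n j f x * pder n i (pder n j f) x) := by
    rw [Finset.sum_comm]
    refine Finset.sum_congr rfl fun i _ => Finset.sum_congr rfl fun j _ => ?_
    rw [pder_comm hf j i]
    ring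
  change ∑ i, pder n i f x * pder n i (gradInner n g f) x
    = _ + 1 / 2 * ∑ i, pder n i g x * pder n i (gradInner n f f) x
  simp only [pder_gradInner hg hf, pder_gradInner hf hf, hessQF, hessij, gradient_apply_eq_pder,
    Finset.mul_sum, mul_add, Finset.sum_add_distrib]
  rw [hsymm]
  simp only [← Finset.sum_add_distrib]
  refine Finset.sum_congr rfl fun i _ => Finset.sum_congr rfl fun j _ => ?_
  ring

/-- The Bochner formula in flat space:
`Δ‖∇f‖² = 2 ‖Hess f‖² + 2 ∇f · ∇Δf`. -/
lemma lapl_gradInner_self (hf : ContDiff ℝ (⊤ : ℕ∞) f) :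
    lapl n (gradInner n f f) x = 2 * hessFrob n f x + 2 * gradInner n f (lapl n f) x := by
  have hsecond (i j : Fin n) := contDiff_pder (contDiff_pder hf j) i
  have hpder (i : Fin n) : pder n i (gradInner n f f)
      = fun y => ∑ j, 2 * (pder n j f y * pder n i (pder n j f) y) := by
    funext y
    rw [pder_gradInner hf hf]
    exact Finset.sum_congr rfl fun j _ => by ring
  have hthird (i j : Fin n) : pder n i (pder n i (pder n j f)) x
      = pder n j (pder n i (pder n i f)) x := by
    rw [show pder n i (pder n j f) = pder n j (pder n i f) from funext fun y => pder_comm hf i j,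
      pder_comm (contDiff_pder hf i)]
  have hlapl (j : Fin n) : pder n j (lapl n f) x = ∑ i, pder n j (pder n i (pder n i f)) x :=
    pder_sum (fun i => hsecond i i) j
  have hsum (i : Fin n) : pder n i (pder n i (gradInner n f f)) x
      = ∑ j, 2 * (pder n j f x * pder n j (pder n i (pder n i f)) x
        + pder n i (pder n j f) x ^ 2) := by
    rw [hpder, pder_sum fun j => contDiff_const.mul ((contDiff_pder hf j).mul (hsecond i j))]
    refine Finset.sum_congr rfl fun j _ => ?_
    rw [pder_const_mul ((contDiff_pder hf j).mul (hsecond i j)),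
      pder_mul (contDiff_pder hf j) (hsecond i j), hthird]
    ring
  have hswap : gradInner n f (lapl n f) x
      = ∑ i, ∑ j, pder n j f x * pder n j (pder n i (pder n i f)) x := by
    simp only [gradInner, hlapl, Finset.mul_sum]
    exact Finset.sum_comm
  rw [hswap]
  change ∑ i, pder n i (pder n i (gradInner n f f)) x
    = 2 * (∑ i, ∑ j, pder n i (pder n j f) x ^ 2) + _
  simp only [hsum, Finset.mul_sum, ← Finset.sum_add_distrib]
  exact Finset.sum_congr rfl fun i _ => Finset.sum_congr rfl fun j _ => by ring

lemma hasCompactSupport_pder (hf : HasCompactSupport f) (j : Fin n) :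
    HasCompactSupport (pder n j f) :=
  hf.fderiv_apply ℝ _

lemma hasCompactSupport_gradInner_right (hg : HasCompactSupport g) :
    HasCompactSupport (gradInner n f g) := by
  refine hg.mono' fun x hx => ?_
  by_contra hxg
  refine hx (Finset.sum_eq_zero fun j _ => ?_)
  have : pder n j g x = 0 := by
    rw [pder, fderiv_of_notMem_tsupport ℝ hxg, _root_.zero_apply]
  rw [this, mul_zero]

lemma integrable_pder (hf : ContDiff ℝ (⊤ : ℕ∞) f) (hc : HasCompactSupport f) (j : Fin n) :
    Integrable (pder n j f) :=
  (contDiff_pder hf j).continuous.integrable_of_hasCompactSupport (hasCompactSupport_pder hc j)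

lemma integral_pder_eq_zero (hf : ContDiff ℝ (⊤ : ℕ∞) f) (hc : HasCompactSupport f)
    (j : Fin n) : ∫ x, pder n j f x = 0 := by
  have h := integral_mul_fderiv_eq_neg_fderiv_mul_of_integrable (μ := volume)
    (f := fun _ : EuclideanSpace ℝ (Fin n) => (1 : ℝ)) (g := f)
    (v := EuclideanSpace.single j 1) (by simp)
    (by simp only [one_mul]; exact integrable_pder hf hc j)
    (by simpa using hf.continuous.integrable_of_hasCompactSupport hc)
    (fun _ _ => differentiableAt_const _) (fun _ _ => hf.differentiableAt_of_top)
  simpa [pder] using h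

/-- The divergence `∇·(f ∇g) = ∇f · ∇g + f Δg` as a function. -/
lemma gradInner_add_mul_lapl (hf : ContDiff ℝ (⊤ : ℕ∞) f) (hg : ContDiff ℝ (⊤ : ℕ∞) g) :
    gradInner n f g x + f x * lapl n g x = ∑ j, pder n j (fun y => f y * pder n j g y) x := by
  simp only [pder_mul hf (contDiff_pder hg _), gradInner, lapl, Finset.mul_sum,
    ← Finset.sum_add_distrib]
  exact Finset.sum_congr rfl fun j _ => by ring

/-- The Green identity when one of the two functions has compact support: the divergence
`∇·(f ∇g)` is integrable with integral zero. -/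
lemma integrable_and_integral_div_eq_zero (hf : ContDiff ℝ (⊤ : ℕ∞) f)
    (hg : ContDiff ℝ (⊤ : ℕ∞) g) (hc : HasCompactSupport f ∨ HasCompactSupport g) :
    Integrable (fun x => gradInner n f g x + f x * lapl n g x) ∧
      ∫ x, (gradInner n f g x + f x * lapl n g x) = 0 := by
  have hsmooth (j : Fin n) := hf.mul (contDiff_pder hg j)
  have hsupp (j : Fin n) : HasCompactSupport fun y => f y * pder n j g y := by
    rcases hc with hc | hc
    · exact hc.mul_right
    · exact (hasCompactSupport_pder hc j).mul_left
  have hint (j : Fin n) := integrable_pder (hsmooth j) (hsupp j) j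
  simp only [gradInner_add_mul_lapl hf hg]
  refine ⟨integrable_finsetSum _ fun j _ => hint j, ?_⟩
  rw [integral_finsetSum _ fun j _ => hint j]
  exact Finset.sum_eq_zero fun j _ => integral_pder_eq_zero (hsmooth j) (hsupp j) j

end PartialDerivatives

lemma integral_sub_eq_left_of_integral_eq_zero {α : Type*} [MeasurableSpace α] {ν : Measure α}
    {f g : α → ℝ} (hg : Integrable g ν) (hg0 : ∫ x, g x ∂ν = 0) :
    ∫ x, (f x - g x) ∂ν = ∫ x, f x ∂ν := by
  by_cases hf : Integrable f ν
  · rw [integral_sub hf hg, hg0, sub_zero]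
  · rw [integral_undef hf, integral_undef]
    exact fun h => hf <| by simpa [Pi.add_def] using h.add hg

lemma Lgen_eq {n : ℕ} {γ : ℝ} (hγ : γ ≠ 1) {μ : EuclideanSpace ℝ (Fin n) → ℝ}
    (hμ : ContDiff ℝ (⊤ : ℕ∞) μ) (hμpos : ∀ x, 0 < μ x) (g : EuclideanSpace ℝ (Fin n) → ℝ) :
    Lgen n γ μ g = fun x => γ / (γ - 1) * gradInner n (fun y => μ y ^ (γ - 1)) g x
      + μ x ^ (γ - 1) * lapl n g x := by
  funext x
  have : γ - 1 ≠ 0 := sub_ne_zero.mpr hγ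
  rw [Lgen, inner_gradient_eq_gradInner, gradInner_rpow_left hμ hμpos,
    show γ - 1 - 1 = γ - 2 by ring]
  field_simp

/-- mean-field Bakry–Émery formula (Proposition 10 + Lemma 7,
flat Euclidean space): `∫ Γ_{γ,2}(Φ,Φ,ρ) ρ dx` equals the explicit Hessian
expression of the γ-divergence. -/
theorem stmt15 (n : ℕ) (hn : 1 ≤ n) (γ : ℝ) (hγ : γ ≠ 1)
    (ρ μ : EuclideanSpace ℝ (Fin n) → ℝ)
    (hρ : ContDiff ℝ (⊤ : ℕ∞) ρ) (hμ : ContDiff ℝ (⊤ : ℕ∞) μ)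
    (hρpos : ∀ x, 0 < ρ x) (hμpos : ∀ x, 0 < μ x)
    (Φ : EuclideanSpace ℝ (Fin n) → ℝ) (hΦ : ContDiff ℝ (⊤ : ℕ∞) Φ)
    (hΦc : HasCompactSupport Φ) :
    ∫ x, Gamma2 n γ μ ρ Φ x * ρ x
      = ∫ x, (ρ x)^γ *
          (-(lapl n (fun y => (μ y)^(γ-1)) x) * ‖gradient Φ x‖^2
            - (1/(γ-1)) * hessQF n (fun y => (μ y)^(γ-1)) x (gradient Φ x)
            + (μ x)^(γ-1) * hessFrob n Φ x
            + γ*(γ-1) * (μ x)^(γ-1) *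
              (⟪(ρ x)⁻¹ • gradient ρ x, gradient Φ x⟫_ℝ
                  * ⟪(μ x)⁻¹ • gradient μ x, gradient Φ x⟫_ℝ
                - (1/2) * ⟪(ρ x)⁻¹ • gradient ρ x,
                    (μ x)⁻¹ • gradient μ x + (ρ x)⁻¹ • gradient ρ x⟫_ℝ
                  * ‖gradient Φ x‖^2)) := by
  have hγ' : γ - 1 ≠ 0 := sub_ne_zero.mpr hγ
  set m : EuclideanSpace ℝ (Fin n) → ℝ := fun y => μ y ^ (γ - 1) with hm_def
  set S : EuclideanSpace ℝ (Fin n) → ℝ := fun y => ρ y ^ (γ - 1) with hS_def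
  set R : EuclideanSpace ℝ (Fin n) → ℝ := fun y => ρ y ^ γ with hR_def
  set F : EuclideanSpace ℝ (Fin n) → ℝ := gradInner n Φ Φ with hF_def
  set G : EuclideanSpace ℝ (Fin n) → ℝ := fun y => F y * S y with hG_def
  have hm : ContDiff ℝ (⊤ : ℕ∞) m := contDiff_rpow_const hμ hμpos _
  have hS : ContDiff ℝ (⊤ : ℕ∞) S := contDiff_rpow_const hρ hρpos _
  have hR : ContDiff ℝ (⊤ : ℕ∞) R := contDiff_rpow_const hρ hρpos _
  have hF : ContDiff ℝ (⊤ : ℕ∞) F := contDiff_gradInner hΦ hΦ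
  have hG : ContDiff ℝ (⊤ : ℕ∞) G := hF.mul hS
  have hmΦ : ContDiff ℝ (⊤ : ℕ∞) (gradInner n m Φ) := contDiff_gradInner hm hΦ
  have hFc : HasCompactSupport F := hasCompactSupport_gradInner_right hΦc
  obtain ⟨i₁, z₁⟩ := integrable_and_integral_div_eq_zero (f := fun y => ρ y * m y)
    (hρ.mul hm) hG (Or.inr hFc.mul_right)
  obtain ⟨i₂, z₂⟩ := integrable_and_integral_div_eq_zero (f := fun y => R y * m y)
    (hR.mul hm) hF (Or.inr hFc)
  obtain ⟨i₃, z₃⟩ := integrable_and_integral_div_eq_zero (f := fun y => R y * F y)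
    (hR.mul hF) hm (Or.inl hFc.mul_left)
  obtain ⟨i₄, z₄⟩ := integrable_and_integral_div_eq_zero (f := fun y => R y * gradInner n m Φ y)
    (hR.mul hmΦ) hΦ (Or.inr hΦc)
  have j₁ := i₁.const_mul (γ / 2)
  have j₂ := i₂.const_mul (1 / 2)
  rw [← integral_sub_eq_left_of_integral_eq_zero (((j₁.sub j₂).add i₃).sub i₄) (by
    rw [integral_sub' ((j₁.sub j₂).add i₃) i₄, integral_add' (j₁.sub j₂) i₃, integral_sub' j₁ j₂,
      integral_const_mul, integral_const_mul, z₁, z₂, z₃, z₄]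
    simp)]
  refine integral_congr_ae (.of_forall fun x => ?_)
  have hGamma (f : EuclideanSpace ℝ (Fin n) → ℝ) :
      Gamma1 n γ ρ Φ f = fun y => gradInner n Φ f y * S y := by
    funext y
    rw [Gamma1, inner_gradient_eq_gradInner]
  have hρx := hρpos x
  have hμx := hμpos x
  have hRx : R x = ρ x ^ (γ - 2) * ρ x ^ 2 := by
    rw [← Real.rpow_natCast, ← Real.rpow_add hρx]
    norm_num [hR_def]
  have hSx : S x = ρ x ^ (γ - 2) * ρ x := by
    rw [← Real.rpow_add_one hρx.ne', hS_def]
    ring_nf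
  have hmx : m x = μ x ^ (γ - 2) * μ x := by
    rw [← Real.rpow_add_one hμx.ne', hm_def]
    ring_nf
  have grad_m (g : EuclideanSpace ℝ (Fin n) → ℝ) :
      gradInner n m g x = (γ - 1) * μ x ^ (γ - 2) * gradInner n μ g x := by
    rw [hm_def, gradInner_rpow_left hμ hμpos, show γ - 1 - 1 = γ - 2 by ring]
  have grad_S (g : EuclideanSpace ℝ (Fin n) → ℝ) :
      gradInner n S g x = (γ - 1) * ρ x ^ (γ - 2) * gradInner n ρ g x := by
    rw [hS_def, gradInner_rpow_left hρ hρpos, show γ - 1 - 1 = γ - 2 by ring]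
  have grad_R (g : EuclideanSpace ℝ (Fin n) → ℝ) :
      gradInner n R g x = γ * (ρ x ^ (γ - 2) * ρ x) * gradInner n ρ g x := by
    rw [← hSx, hR_def, gradInner_rpow_left hρ hρpos]
  have grad_L : gradInner n Φ (Lgen n γ μ Φ) x
      = γ / (γ - 1) * (hessQF n m x (gradient Φ x) + 1 / 2 * gradInner n m F x)
        + (m x * gradInner n Φ (lapl n Φ) x + lapl n Φ x * gradInner n m Φ x) := by
    rw [Lgen_eq hγ hμ hμpos, gradInner_add_right (contDiff_const.mul hmΦ)
      (hm.mul (contDiff_lapl hΦ)), gradInner_const_mul_right hmΦ, gradInner_gradInner hΦ hm,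
      gradInner_mul_right hm (contDiff_lapl hΦ), gradInner_comm (f := Φ) (g := m)]
  have grad_ρG : gradInner n ρ G x
      = F x * ((γ - 1) * ρ x ^ (γ - 2) * gradInner n ρ ρ x) + S x * gradInner n ρ F x := by
    rw [hG_def, gradInner_mul_right hF hS, gradInner_comm (f := ρ) (g := S), grad_S]
  have grad_μG : gradInner n μ G x
      = F x * ((γ - 1) * ρ x ^ (γ - 2) * gradInner n ρ μ x) + S x * gradInner n μ F x := by
    rw [hG_def, gradInner_mul_right hF hS, gradInner_comm (f := μ) (g := S), grad_S]
  simp only [Pi.add_apply, Pi.sub_apply, Gamma2, hGamma, ← hF_def, ← hG_def]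
  rw [grad_L, Lgen_eq hγ hμ hμpos, gradInner_mul_left hρ hm, gradInner_mul_left hR hm,
    gradInner_mul_left hR hF, gradInner_mul_left hR hmΦ, lapl_gradInner_self hΦ,
    gradInner_comm (f := gradInner n m Φ) (g := Φ), gradInner_gradInner hΦ hm,
    gradInner_comm (f := F) (g := m)]
  simp only [inner_add_right, real_inner_smul_left, real_inner_smul_right,
    inner_gradient_eq_gradInner, norm_gradient_sq_eq_gradInner, ← hF_def, ← hm_def, grad_R]
  have hRx' : ρ x ^ γ = ρ x ^ (γ - 2) * ρ x ^ 2 := hRx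
  have hmx' : μ x ^ (γ - 1) = μ x ^ (γ - 2) * μ x := hmx
  rw [gradInner_comm (f := ρ) (g := m)]
  simp only [grad_m, grad_ρG, grad_μG, hRx, hSx, hmx, hRx', hmx']
  rw [gradInner_comm (f := μ) (g := ρ)]
  field_simp
  ring
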